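/- arXiv:1702.05770 — 2 statements merged into one kernel-verified Lean document; each statement's English description precedes it below -/
import Mathlib

section
/- Let n, m be natural numbers, let J : Matrix (Fin n) (Fin n) ℝ be skew-symmetric (Jᵀ = -J), let R : Matrix (Fin n) (Fin n) ℝ be symmetric positive semidefinite, and let G : Matrix (Fin n) (Fin m) ℝ. Let H : EuclideanSpace ℝ (Fin n) → ℝ be continuously differentiable with H(y) ≥ 0 for all y. Suppose x : ℝ → EuclideanSpace ℝ (Fin n) and F : ℝ → EuclideanSpace ℝ (Fin m) are continuous, and for every t ≥ 0, x is differentiable at t with x'(t) = (J - R) (∇H(x(t))) + G (F(t)). Define the output v(t) = Gᵀ (∇H(x(t))). Then for every T ≥ 0, ∫_0^T ⟨F(τ), v(τ)⟩ dτ ≥ -H(x(0)); that is, the system is passive with respect to the input–output pair (F, v). -/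
open MeasureTheory Matrix
open scoped RealInnerProductSpace

/-- A continuously differentiable function has a continuous gradient. -/
theorem ContDiff.continuous_gradient {E : Type*} [NormedAddCommGroup E] [InnerProductSpace ℝ E]
    [CompleteSpace E] {f : E → ℝ} (hf : ContDiff ℝ 1 f) : Continuous (gradient f) :=
  (InnerProductSpace.toDual ℝ E).symm.continuous.comp (hf.continuous_fderiv one_ne_zero)

theorem HasGradientAt.comp_hasDerivAt {E : Type*} [NormedAddCommGroup E] [InnerProductSpace ℝ E]
    [CompleteSpace E] {f : E → ℝ} {g : E} {x : ℝ → E} {x' : E} {t : ℝ}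
    (hf : HasGradientAt f g (x t)) (hx : HasDerivAt x x' t) :
    HasDerivAt (fun s => f (x s)) ⟪g, x'⟫ t := by
  simpa [Function.comp_def] using hf.hasFDerivAt.comp_hasDerivAt t hx

theorem Matrix.inner_toEuclideanLin_transpose {n m : Type*} [Fintype n] [Fintype m]
    [DecidableEq n] [DecidableEq m] (A : Matrix n m ℝ)
    (x : EuclideanSpace ℝ m) (y : EuclideanSpace ℝ n) :
    ⟪x, Matrix.toEuclideanLin Aᵀ y⟫ = ⟪Matrix.toEuclideanLin A x, y⟫ := by
  rw [← conjTranspose_eq_transpose_of_trivial, toEuclideanLin_conjTranspose_eq_adjoint,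
    LinearMap.adjoint_inner_right]

theorem Matrix.inner_toEuclideanLin_self_eq_zero {n : Type*} [Fintype n] [DecidableEq n]
    {J : Matrix n n ℝ} (hJ : Jᵀ = -J) (x : EuclideanSpace ℝ n) :
    ⟪x, Matrix.toEuclideanLin J x⟫ = 0 := by
  have h := inner_toEuclideanLin_transpose J x x
  rw [hJ, map_neg, LinearMap.neg_apply, inner_neg_right, real_inner_comm x] at h
  linarith

/-- The energy balance inequality: the power stored is at most the power supplied. -/
theorem Matrix.inner_portHamiltonian_le {n m : Type*} [Fintype n] [Fintype m]
    [DecidableEq n] [DecidableEq m] {J R : Matrix n n ℝ} (hJ : Jᵀ = -J) (hR : R.PosSemidef)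
    (G : Matrix n m ℝ) (g : EuclideanSpace ℝ n) (u : EuclideanSpace ℝ m) :
    ⟪g, Matrix.toEuclideanLin (J - R) g + Matrix.toEuclideanLin G u⟫ ≤
      ⟪u, Matrix.toEuclideanLin Gᵀ g⟫ := by
  have hRg : 0 ≤ ⟪g, Matrix.toEuclideanLin R g⟫ := by
    simpa using (isPositive_toEuclideanLin_iff.mpr hR).re_inner_nonneg_right g
  rw [inner_toEuclideanLin_transpose, map_sub, LinearMap.sub_apply, inner_add_right,
    inner_sub_right, inner_toEuclideanLin_self_eq_zero hJ, real_inner_comm g]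
  linarith

/-- Passivity of a port-Hamiltonian system `x' = (J - R)∇H(x) + G F`,
with collocated output `v = Gᵀ∇H(x)`: for every `T ≥ 0`,
`∫_0^T ⟨F, v⟩ ≥ -H(x 0)`. -/
theorem stmt_0 (n m : ℕ) (J R : Matrix (Fin n) (Fin n) ℝ)
    (hJ : Jᵀ = -J) (hR : R.PosSemidef)
    (G : Matrix (Fin n) (Fin m) ℝ)
    (H : EuclideanSpace ℝ (Fin n) → ℝ) (hH : ContDiff ℝ 1 H)
    (hHnonneg : ∀ y, 0 ≤ H y)
    (x : ℝ → EuclideanSpace ℝ (Fin n)) (F : ℝ → EuclideanSpace ℝ (Fin m))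
    (hx : Continuous x) (hF : Continuous F)
    (hdyn : ∀ t, 0 ≤ t → HasDerivAt x
      (Matrix.toEuclideanLin (J - R) (gradient H (x t)) + Matrix.toEuclideanLin G (F t)) t)
    (v : ℝ → EuclideanSpace ℝ (Fin m))
    (hv : ∀ t, v t = Matrix.toEuclideanLin Gᵀ (gradient H (x t))) :
    ∀ T, 0 ≤ T → -H (x 0) ≤ ∫ τ in (0:ℝ)..T, ⟪F τ, v τ⟫ := by
  intro T hT
  have hgrad : Continuous fun t => gradient H (x t) := hH.continuous_gradient.comp hx
  have hv_cont : Continuous v := by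
    rw [funext hv]
    exact (Matrix.toEuclideanLin Gᵀ).continuous_of_finiteDimensional.comp hgrad
  have hpower : Continuous fun τ => ⟪F τ, v τ⟫ := hF.inner hv_cont
  have hbalance : H (x T) - H (x 0) ≤ ∫ τ in (0:ℝ)..T, ⟪F τ, v τ⟫ := by
    refine intervalIntegral.sub_le_integral_of_hasDeriv_right_of_le hT
      (hH.continuous.comp hx).continuousOn (fun t ht => ?_)
      hpower.continuousOn.integrableOn_Icc (fun t _ => ?_)
      (g' := fun t => ⟪gradient H (x t),
        Matrix.toEuclideanLin (J - R) (gradient H (x t)) + Matrix.toEuclideanLin G (F t)⟫)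
    · exact ((hH.differentiable one_ne_zero (x t)).hasGradientAt.comp_hasDerivAt
        (hdyn t ht.1.le)).hasDerivWithinAt
    · rw [hv]
      exact Matrix.inner_portHamiltonian_le hJ hR G _ _
  linarith [hHnonneg (x T)]
end

section
/- Consider N robots with positions x_i : ℝ → EuclideanSpace ℝ (Fin 3), i = 1, …, N, each twice differentiable, masses m_i > 0, local damping coefficients b_i ≥ 0, symmetric inter-robot damping gains β_{i,j} = β_{j,i} ≥ 0, continuous external forces F_i : ℝ → EuclideanSpace ℝ (Fin 3), and a continuously differentiable coupling potential V : EuclideanSpace ℝ (Fin 3) → ℝ satisfying V(-y) = V(y) for all y. Suppose the robots obey the dynamics m_i x_i''(t) + b_i x_i'(t) + Σ_{j ≠ i} ∇V(x_i(t) - x_j(t)) + Σ_{j ≠ i} β_{i,j} (x_i'(t) - x_j'(t)) = F_i(t) for all i and t. Define the total energy H(t) = Σ_{i=1}^N (m_i/2)‖x_i'(t)‖² + Σ_{i < j} V(x_i(t) - x_j(t)). Then for every t, H is differentiable at t with H'(t) = Σ_{i=1}^N ⟨F_i(t), x_i'(t)⟩ - Σ_{i=1}^N b_i ‖x_i'(t)‖²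 - Σ_{i < j} β_{i,j} ‖x_i'(t) - x_j'(t)‖². -/
open MeasureTheory Finset
open scoped RealInnerProductSpace

/-- The gradient of an even function is odd. -/
theorem gradient_neg_of_even {E : Type*} [NormedAddCommGroup E] [InnerProductSpace ℝ E]
    [CompleteSpace E] {V : E → ℝ} (hV : ∀ y, V (-y) = V y) (y : E) :
    gradient V (-y) = -gradient V y := by
  have h : fderiv ℝ V (-y) = -fderiv ℝ V y := by
    have h' := (ContinuousLinearEquiv.neg ℝ (M := E)).comp_right_fderiv (f := V) (x := y)
    have hc : V ∘ ContinuousLinearEquiv.neg ℝ (M := E) = V := funext hV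
    rw [hc] at h'
    ext v
    simp [h']
  simp [gradient, h]

/-- The power of reciprocal pairwise forces depends only on the relative velocities. -/
theorem sum_inner_eq_sum_Ioi_inner_sub {ι E : Type*} [Fintype ι] [LinearOrder ι]
    [LocallyFiniteOrderTop ι] [LocallyFiniteOrderBot ι]
    [NormedAddCommGroup E] [InnerProductSpace ℝ E]
    (G : ι → ι → E) (hG : ∀ i j, G j i = -G i j) (v : ι → E) :
    ∑ i, ⟪∑ j ∈ univ.filter (· ≠ i), G i j, v i⟫ =
      ∑ i, ∑ j ∈ Ioi i, ⟪G i j, v i - v j⟫ := by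
  have h := sum_sum_Ioi_add_eq_sum_sum_off_diag (fun j i => ⟪G i j, v i⟫)
  have hs (i : ι) : univ.filter (· ≠ i) = ({i}ᶜ : Finset ι) := by ext; simp
  simp only [sum_inner, hs]
  rw [← h]
  refine sum_congr rfl fun i _ => sum_congr rfl fun j _ => ?_
  rw [hG i j, inner_neg_left, inner_sub_right]
  ring

/-- Energy balance for `N` robots `m_i ẍ_i + b_i ẋ_i + Σ_{j≠i} ∇V(x_i - x_j)
+ Σ_{j≠i} β_{i,j}(ẋ_i - ẋ_j) = F_i`: the total energy
`H = Σ_i (m_i/2)‖ẋ_i‖² + Σ_{i<j} V(x_i - x_j)` satisfies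
`Ḣ = Σ_i ⟨F_i, ẋ_i⟩ - Σ_i b_i‖ẋ_i‖² - Σ_{i<j} β_{i,j}‖ẋ_i - ẋ_j‖²`. -/
theorem stmt_3 (N : ℕ)
    (x x' x'' : Fin N → ℝ → EuclideanSpace ℝ (Fin 3))
    (hx' : ∀ i t, HasDerivAt (x i) (x' i t) t)
    (hx'' : ∀ i t, HasDerivAt (x' i) (x'' i t) t)
    (m : Fin N → ℝ) (hm : ∀ i, 0 < m i)
    (b : Fin N → ℝ) (hb : ∀ i, 0 ≤ b i)
    (β : Fin N → Fin N → ℝ) (hβsymm : ∀ i j, β i j = β j i) (hβ : ∀ i j, 0 ≤ β i j)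
    (F : Fin N → ℝ → EuclideanSpace ℝ (Fin 3)) (hF : ∀ i, Continuous (F i))
    (V : EuclideanSpace ℝ (Fin 3) → ℝ) (hV : ContDiff ℝ 1 V)
    (hVeven : ∀ y, V (-y) = V y)
    (hdyn : ∀ i t, m i • x'' i t + b i • x' i t
        + (∑ j ∈ univ.filter (· ≠ i), gradient V (x i t - x j t))
        + (∑ j ∈ univ.filter (· ≠ i), β i j • (x' i t - x' j t)) = F i t)
    (H : ℝ → ℝ)
    (hH : ∀ t, H t = (∑ i, m i / 2 * ‖x' i t‖ ^ 2)
        + ∑ i, ∑ j ∈ Ioi i, V (x i t - x j t)) :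
    ∀ t, HasDerivAt H
      ((∑ i, ⟪F i t, x' i t⟫) - (∑ i, b i * ‖x' i t‖ ^ 2)
        - ∑ i, ∑ j ∈ Ioi i, β i j * ‖x' i t - x' j t‖ ^ 2) t := by
  intro t
  have hkin (i : Fin N) : HasDerivAt (fun s => m i / 2 * ‖x' i s‖ ^ 2)
      (⟪m i • x'' i t, x' i t⟫) t := by
    have h := ((hx'' i t).norm_sq).const_mul (m i / 2)
    have he : m i / 2 * (2 * ⟪x' i t, x'' i t⟫) = ⟪m i • x'' i t, x' i t⟫ := by
      rw [real_inner_smul_left, real_inner_comm]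
      ring
    exact he ▸ h
  have hpot (i j : Fin N) : HasDerivAt (fun s => V (x i s - x j s))
      (⟪gradient V (x i t - x j t), x' i t - x' j t⟫) t := by
    have hg := (hV.differentiable one_ne_zero (x i t - x j t)).hasGradientAt
    exact hg.hasFDerivAt.comp_hasDerivAt t ((hx' i t).sub (hx' j t))
  have hH' : HasDerivAt H ((∑ i, ⟪m i • x'' i t, x' i t⟫)
      + ∑ i, ∑ j ∈ Ioi i, ⟪gradient V (x i t - x j t), x' i t - x' j t⟫) t := by
    rw [funext hH]
    exact (HasDerivAt.fun_sum fun i _ => hkin i).fun_add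
      (HasDerivAt.fun_sum fun i _ => HasDerivAt.fun_sum fun j _ => hpot i j)
  refine hH'.congr_deriv (Eq.symm ?_)
  have hel := sum_inner_eq_sum_Ioi_inner_sub (fun i j => gradient V (x i t - x j t))
    (fun i j => by rw [← neg_sub, gradient_neg_of_even hVeven]) (fun i => x' i t)
  have hdamp := sum_inner_eq_sum_Ioi_inner_sub (fun i j => β i j • (x' i t - x' j t))
    (fun i j => by rw [hβsymm j i, ← smul_neg, neg_sub]) (fun i => x' i t)
  simp only [real_inner_smul_left, real_inner_self_eq_norm_sq] at hdamp
  rw [← hel, ← hdamp]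
  simp only [← hdyn, inner_add_left, sum_add_distrib, real_inner_smul_left,
    real_inner_self_eq_norm_sq]
  ring
end
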